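/- arXiv:1204.5763 — 2 statements merged into one kernel-verified Lean document; each statement's English description precedes it below -/
import Mathlib

section
/- Let T > 0. Let u : [0,T] × ℝ² → ℝ², p : [0,T] × ℝ² → ℝ, V : [0,T] × ℝ² → Matrix (Fin 2) (Fin 2) ℝ and γ : [0,T] × ℝ² → ℝ be C², with V(t,x) symmetric for all (t,x), all compactly supported in the spatial variable uniformly in t. Assume that pointwise on [0,T] × ℝ²: (i) ∇·u = 0; (ii) ∂_t u + (u·∇)u + ∇p = Δu + ∇·(V Vᵀ) + 2 ∇·V; (iii) ∂_t V + (u·∇)V = S(u) + ½((∇u) V + V (∇u)ᵀ) + ½(ω₁₂(u) − γ)(V A − A V), where ω₁₂(u) = ½(∂₂u₁ − ∂₁u₂) and S(u) = ½(∇u + (∇u)ᵀ). Then the energy E(t) = ∫_{ℝ²} ( |u(t,x)|² + Σ_{i,j} V_{ij}(t,x)² + 2 tr V(t,x) ) dx is differentiable on [0,T] and satisfies the basic energy law E'(t) = − 2 ∫_{ℝ²} |∇u(t,x)|² dx for all t ∈ [0,T]. -/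
open Matrix MeasureTheory

/-- The spatial partial derivative in the `i`-th coordinate direction of a
scalar function of time and space. -/
noncomputable def pds (i : Fin 2) (f : ℝ × (Fin 2 → ℝ) → ℝ) (t : ℝ)
    (x : Fin 2 → ℝ) : ℝ :=
  fderiv ℝ (fun y => f (t, y)) x (Pi.single i 1)

/-- The spatial gradient matrix of a time-dependent vector field:
`(∇u)_{ij} = ∂_i u_j`. -/
noncomputable def gradMats (u : ℝ × (Fin 2 → ℝ) → (Fin 2 → ℝ)) (t : ℝ)
    (x : Fin 2 → ℝ) : Matrix (Fin 2) (Fin 2) ℝ :=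
  Matrix.of fun i j => pds i (fun q => u q j) t x

/-- The spatial divergence of a time-dependent matrix field:
`(∇·M)_j = Σ_i ∂_i M_{ij}`. -/
noncomputable def matDivs (M : ℝ × (Fin 2 → ℝ) → Matrix (Fin 2) (Fin 2) ℝ)
    (t : ℝ) (x : Fin 2 → ℝ) : Fin 2 → ℝ :=
  fun j => ∑ i, pds i (fun q => M q i j) t x

/-- The constant rotation matrix `A = [[0, -1], [1, 0]]`. -/
def Arot : Matrix (Fin 2) (Fin 2) ℝ := !![0, -1; 1, 0]


local notation "X2" => (Fin 2 → ℝ)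

lemma aux_slice {f : ℝ × X2 → ℝ} (hf : ContDiff ℝ 1 f) (t : ℝ) (x : X2) :
    DifferentiableAt ℝ (fun y => f (t, y)) x := by
  have : ContDiff ℝ 1 (fun y => f (t, y)) := by fun_prop
  exact this.differentiable one_ne_zero x

lemma aux_sliceT {f : ℝ × X2 → ℝ} (hf : ContDiff ℝ 1 f) (t : ℝ) (x : X2) :
    HasDerivAt (fun s => f (s, x)) (deriv (fun s => f (s, x)) t) t := by
  have : ContDiff ℝ 1 (fun s => f (s, x)) := by fun_prop
  exact (this.differentiable one_ne_zero t).hasDerivAt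

lemma pds_add' (i : Fin 2) {f g : ℝ × X2 → ℝ} (hf : ContDiff ℝ 1 f) (hg : ContDiff ℝ 1 g)
    (t : ℝ) (x : X2) :
    pds i (fun q => f q + g q) t x = pds i f t x + pds i g t x := by
  unfold pds
  rw [fderiv_fun_add (aux_slice hf t x) (aux_slice hg t x)]; rfl

lemma pds_mul' (i : Fin 2) {f g : ℝ × X2 → ℝ} (hf : ContDiff ℝ 1 f) (hg : ContDiff ℝ 1 g)
    (t : ℝ) (x : X2) :
    pds i (fun q => f q * g q) t x = f (t, x) * pds i g t x + g (t, x) * pds i f t x := by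
  unfold pds
  rw [fderiv_fun_mul (aux_slice hf t x) (aux_slice hg t x)]; rfl

lemma pds_cmul' (i : Fin 2) (c : ℝ) {f : ℝ × X2 → ℝ} (hf : ContDiff ℝ 1 f)
    (t : ℝ) (x : X2) :
    pds i (fun q => c * f q) t x = c * pds i f t x := by
  unfold pds
  rw [fderiv_const_mul (aux_slice hf t x)]; rfl

lemma pds_eq (i : Fin 2) {f : ℝ × X2 → ℝ} (hf : ContDiff ℝ 1 f) (t : ℝ) (x : X2) :
    pds i f t x = fderiv ℝ f (t, x) (0, Pi.single i 1) := by
  unfold pds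
  have h1 : HasFDerivAt f (fderiv ℝ f (t, x)) (t, x) :=
    (hf.differentiable one_ne_zero _).hasFDerivAt
  have h2 := h1.comp x (hasFDerivAt_prodMk_right (𝕜 := ℝ) t x)
  have h3 : fderiv ℝ (fun y => f (t, y)) x = _ := h2.fderiv
  rw [h3]; simp

lemma dt_eq {f : ℝ × X2 → ℝ} (hf : ContDiff ℝ 1 f) (t : ℝ) (x : X2) :
    deriv (fun s => f (s, x)) t = fderiv ℝ f (t, x) (1, 0) := by
  have h1 : HasFDerivAt f (fderiv ℝ f (t, x)) (t, x) :=
    (hf.differentiable one_ne_zero _).hasFDerivAt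
  have h2 := h1.comp t (hasFDerivAt_prodMk_left (𝕜 := ℝ) t x)
  have h3 : deriv (fun s => f (s, x)) t = _ := h2.hasDerivAt.deriv
  rw [h3]; simp

lemma pds_contDiff (i : Fin 2) {f : ℝ × X2 → ℝ} (hf : ContDiff ℝ 2 f) :
    ContDiff ℝ 1 (fun q : ℝ × X2 => pds i f q.1 q.2) := by
  have hf1 : ContDiff ℝ 1 f := hf.of_le (by norm_num)
  have : (fun q : ℝ × X2 => pds i f q.1 q.2)
      = fun q => fderiv ℝ f q (0, Pi.single i 1) := by
    funext q; exact pds_eq i hf1 q.1 q.2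
  rw [this]
  exact (hf.fderiv_right (m := 1) (by norm_num)).clm_apply contDiff_const

lemma dt_integral {e : ℝ × X2 → ℝ} (he : ContDiff ℝ 1 e) {K : Set X2} (hK : IsCompact K)
    (h0 : ∀ t x, x ∉ K → e (t, x) = 0) (t : ℝ) :
    HasDerivAt (fun s => ∫ x : X2, e (s, x)) (∫ x : X2, deriv (fun s => e (s, x)) t) t := by
  have hc : Continuous (fun q : ℝ × X2 => fderiv ℝ e q (1, 0)) :=
    (he.continuous_fderiv one_ne_zero).clm_apply continuous_const
  obtain ⟨C, hC⟩ := ((isCompact_closedBall t 1).prod hK).exists_bound_of_continuousOn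
    hc.continuousOn
  have hd0 : ∀ s x, x ∉ K → deriv (fun s => e (s, x)) s = 0 := by
    intro s x hx
    have : (fun s => e (s, x)) = fun _ => 0 := by funext s; exact h0 s x hx
    rw [this]; simp
  have hcs : ∀ s, Continuous (fun x : X2 => e (s, x)) := fun s =>
    he.continuous.comp (by fun_prop)
  refine (hasDerivAt_integral_of_dominated_loc_of_deriv_le (μ := volume)
    (F := fun s x => e (s, x)) (F' := fun s x => deriv (fun s => e (s, x)) s)
    (bound := K.indicator (fun _ => C)) (s := Metric.closedBall t 1)
    (Metric.closedBall_mem_nhds t one_pos) ?_ ?_ ?_ ?_ ?_ ?_).2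
  · exact Filter.Eventually.of_forall fun s => (hcs s).aestronglyMeasurable
  · exact (hcs t).integrable_of_hasCompactSupport (HasCompactSupport.intro hK (h0 t))
  · have : (fun x : X2 => deriv (fun s => e (s, x)) t) = fun x => fderiv ℝ e (t, x) (1, 0) := by
      funext x; exact dt_eq he t x
    rw [this]
    exact (hc.comp (f := fun x : X2 => (t, x)) (by fun_prop)).aestronglyMeasurable
  · refine Filter.Eventually.of_forall fun x s hs => ?_
    by_cases hx : x ∈ K
    · rw [Set.indicator_of_mem hx, dt_eq he]
      exact hC (s, x) ⟨hs, hx⟩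
    · rw [Set.indicator_of_notMem hx, hd0 s x hx]; simp
  · rw [integrable_indicator_iff hK.measurableSet]
    exact integrableOn_const hK.measure_lt_top.ne
  · exact Filter.Eventually.of_forall fun x s _ => aux_sliceT he s x

lemma pds_zero_off (i : Fin 2) {g : ℝ × X2 → ℝ} {K : Set X2} (hK : IsCompact K)
    (h0 : ∀ t x, x ∉ K → g (t, x) = 0) (t : ℝ) (x : X2) (hx : x ∉ K) :
    pds i g t x = 0 := by
  unfold pds
  have : (fun y => g (t, y)) =ᶠ[nhds x] fun _ => 0 := by
    filter_upwards [hK.isClosed.isOpen_compl.mem_nhds hx] with y hy using h0 t y hy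
  rw [this.fderiv_eq]; simp

lemma pds_cont (i : Fin 2) {g : ℝ × X2 → ℝ} (hg : ContDiff ℝ 1 g) (t : ℝ) :
    Continuous (fun x => pds i g t x) := by
  have : (fun x => pds i g t x) = fun x => fderiv ℝ g (t, x) (0, Pi.single i 1) := by
    funext x; exact pds_eq i hg t x
  rw [this]
  exact ((hg.continuous_fderiv one_ne_zero).clm_apply continuous_const).comp
    (f := fun x : X2 => (t, x)) (by fun_prop)

lemma pds_integrable (i : Fin 2) {g : ℝ × X2 → ℝ} (hg : ContDiff ℝ 1 g) {K : Set X2}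
    (hK : IsCompact K) (h0 : ∀ t x, x ∉ K → g (t, x) = 0) (t : ℝ) :
    Integrable (fun x => pds i g t x) :=
  (pds_cont i hg t).integrable_of_hasCompactSupport
    (HasCompactSupport.intro hK (pds_zero_off i hK h0 t))

lemma pds_integral (i : Fin 2) {g : ℝ × X2 → ℝ} (hg : ContDiff ℝ 1 g) {K : Set X2}
    (hK : IsCompact K) (h0 : ∀ t x, x ∉ K → g (t, x) = 0) (t : ℝ) :
    ∫ x, pds i g t x = 0 := by
  have hi := pds_integrable i hg hK h0 t
  have hgi : Integrable (fun x : X2 => g (t, x)) :=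
    (hg.continuous.comp (f := fun x : X2 => (t, x))
      (by fun_prop)).integrable_of_hasCompactSupport (HasCompactSupport.intro hK (h0 t))
  have := integral_mul_fderiv_eq_neg_fderiv_mul_of_integrable (μ := (volume : Measure X2))
    (f := fun _ => (1 : ℝ)) (g := fun y : X2 => g (t, y)) (v := Pi.single i 1)
    (by simp) (by simpa [pds] using hi) (by simpa using hgi)
    (by fun_prop) (fun x _ => aux_slice hg t x)
  simpa [pds] using this

lemma core {v w p a b c : ℝ × X2 → ℝ} (hv : ContDiff ℝ 2 v) (hw : ContDiff ℝ 2 w)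
    (hp : ContDiff ℝ 2 p) (ha : ContDiff ℝ 2 a) (hb : ContDiff ℝ 2 b) (hc : ContDiff ℝ 2 c)
    {K : Set X2} (hK : IsCompact K)
    (v0 : ∀ t x, x ∉ K → v (t, x) = 0) (w0 : ∀ t x, x ∉ K → w (t, x) = 0)
    (a0 : ∀ t x, x ∉ K → a (t, x) = 0) (b0 : ∀ t x, x ∉ K → b (t, x) = 0)
    (c0 : ∀ t x, x ∉ K → c (t, x) = 0) (t : ℝ) (R : X2 → ℝ)
    (hdiv : ∀ x, pds 0 v t x + pds 1 w t x = 0)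
    (hm0 : ∀ x, deriv (fun s => v (s, x)) t
      + (v (t, x) * pds 0 v t x + w (t, x) * pds 1 v t x) + pds 0 p t x
      = (pds 0 (fun q => pds 0 v q.1 q.2) t x + pds 1 (fun q => pds 1 v q.1 q.2) t x)
        + (pds 0 (fun q => a q * a q + b q * b q) t x
          + pds 1 (fun q => b q * a q + c q * b q) t x)
        + 2 * (pds 0 a t x + pds 1 b t x))
    (hm1 : ∀ x, deriv (fun s => w (s, x)) t
      + (v (t, x) * pds 0 w t x + w (t, x) * pds 1 w t x) + pds 1 p t x
      = (pds 0 (fun q => pds 0 w q.1 q.2) t x + pds 1 (fun q => pds 1 w q.1 q.2) t x)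
        + (pds 0 (fun q => a q * b q + b q * c q) t x
          + pds 1 (fun q => b q * b q + c q * c q) t x)
        + 2 * (pds 0 b t x + pds 1 c t x))
    (hs00 : ∀ x, deriv (fun s => a (s, x)) t
      + (v (t, x) * pds 0 a t x + w (t, x) * pds 1 a t x)
      = pds 0 v t x + (pds 0 v t x * a (t, x) + pds 0 w t x * b (t, x)) + 2 * R x * b (t, x))
    (hs01 : ∀ x, deriv (fun s => b (s, x)) t
      + (v (t, x) * pds 0 b t x + w (t, x) * pds 1 b t x)
      = 2⁻¹ * (pds 0 w t x + pds 1 v t x)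
        + 2⁻¹ * (pds 0 v t x * b (t, x) + pds 0 w t x * c (t, x)
          + (a (t, x) * pds 1 v t x + b (t, x) * pds 1 w t x))
        + R x * (c (t, x) - a (t, x)))
    (hs11 : ∀ x, deriv (fun s => c (s, x)) t
      + (v (t, x) * pds 0 c t x + w (t, x) * pds 1 c t x)
      = pds 1 w t x + (pds 1 v t x * b (t, x) + pds 1 w t x * c (t, x)) - 2 * R x * b (t, x)) :
    HasDerivAt (fun s => ∫ x : X2, ((v (s, x) ^ 2 + w (s, x) ^ 2)
        + ((a (s, x) ^ 2 + b (s, x) ^ 2) + (b (s, x) ^ 2 + c (s, x) ^ 2))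
        + 2 * (a (s, x) + c (s, x))))
      (-2 * ∫ x : X2, ((pds 0 v t x ^ 2 + pds 0 w t x ^ 2)
        + (pds 1 v t x ^ 2 + pds 1 w t x ^ 2))) t := by
  have hv1 : ContDiff ℝ 1 v := hv.of_le (by norm_num)
  have hw1 : ContDiff ℝ 1 w := hw.of_le (by norm_num)
  have hp1 : ContDiff ℝ 1 p := hp.of_le (by norm_num)
  have ha1 : ContDiff ℝ 1 a := ha.of_le (by norm_num)
  have hb1 : ContDiff ℝ 1 b := hb.of_le (by norm_num)
  have hc1 : ContDiff ℝ 1 c := hc.of_le (by norm_num)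
  have hv0' := pds_contDiff 0 hv
  have hv1' := pds_contDiff 1 hv
  have hw0' := pds_contDiff 0 hw
  have hw1' := pds_contDiff 1 hw
  let H : ℝ × X2 → ℝ := fun q => v q * v q + w q * w q + 2 * p q
    + (a q * a q + 2 * (b q * b q) + c q * c q) + 2 * (a q + c q)
  have hH : ContDiff ℝ 1 H := by fun_prop
  have hHd : ∀ i x, pds i H t x = 2 * (v (t, x) * pds i v t x) + 2 * (w (t, x) * pds i w t x)
      + 2 * pds i p t x + 2 * (a (t, x) * pds i a t x) + 4 * (b (t, x) * pds i b t x)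
      + 2 * (c (t, x) * pds i c t x) + 2 * (pds i a t x + pds i c t x) := by
    intro i x
    simp (disch := fun_prop) only [H, pds_add', pds_cmul', pds_mul']
    ring
  let F0 : ℝ × X2 → ℝ := fun q => -1 * (v q * H q)
    + 2 * (v q * pds 0 v q.1 q.2 + w q * pds 0 w q.1 q.2)
    + 2 * (v q * (a q * a q + b q * b q) + w q * (a q * b q + b q * c q))
    + 4 * (v q * a q + w q * b q)
  let F1 : ℝ × X2 → ℝ := fun q => -1 * (w q * H q)
    + 2 * (v q * pds 1 v q.1 q.2 + w q * pds 1 w q.1 q.2)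
    + 2 * (v q * (b q * a q + c q * b q) + w q * (b q * b q + c q * c q))
    + 4 * (v q * b q + w q * c q)
  have hF0 : ContDiff ℝ 1 F0 := by fun_prop
  have hF1 : ContDiff ℝ 1 F1 := by fun_prop
  have z0 : ∀ t x, x ∉ K → F0 (t, x) = 0 := by
    intro t x hx; simp [F0, v0 t x hx, w0 t x hx]
  have z1 : ∀ t x, x ∉ K → F1 (t, x) = 0 := by
    intro t x hx; simp [F1, v0 t x hx, w0 t x hx]
  have key := dt_integral (e := fun q => ((v q ^ 2 + w q ^ 2)
        + ((a q ^ 2 + b q ^ 2) + (b q ^ 2 + c q ^ 2))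
        + 2 * (a q + c q))) (by fun_prop) hK
        (by intro t x hx
            simp [v0 t x hx, w0 t x hx, a0 t x hx, b0 t x hx, c0 t x hx]) t
  convert key using 1
  have hgi : Integrable (fun x : X2 => ((pds 0 v t x ^ 2 + pds 0 w t x ^ 2)
        + (pds 1 v t x ^ 2 + pds 1 w t x ^ 2))) := by
    have k1 := pds_cont 0 hv1 t
    have k2 := pds_cont 0 hw1 t
    have k3 := pds_cont 1 hv1 t
    have k4 := pds_cont 1 hw1 t
    refine Continuous.integrable_of_hasCompactSupport (by fun_prop)
      (HasCompactSupport.intro hK ?_)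
    intro x hx
    simp [pds_zero_off _ hK v0 t x hx, pds_zero_off _ hK w0 t x hx]
  have pt : ∀ x, deriv (fun s => ((v (s, x) ^ 2 + w (s, x) ^ 2)
        + ((a (s, x) ^ 2 + b (s, x) ^ 2) + (b (s, x) ^ 2 + c (s, x) ^ 2))
        + 2 * (a (s, x) + c (s, x)))) t
      = -2 * ((pds 0 v t x ^ 2 + pds 0 w t x ^ 2)
        + (pds 1 v t x ^ 2 + pds 1 w t x ^ 2)) + (pds 0 F0 t x + pds 1 F1 t x) := by
    intro x
    have dv := aux_sliceT hv1 t x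
    have dw := aux_sliceT hw1 t x
    have da := aux_sliceT ha1 t x
    have db := aux_sliceT hb1 t x
    have dc := aux_sliceT hc1 t x
    have dd := (((dv.fun_pow 2).fun_add (dw.fun_pow 2)).fun_add
      (((da.fun_pow 2).fun_add (db.fun_pow 2)).fun_add
        ((db.fun_pow 2).fun_add (dc.fun_pow 2)))).fun_add ((da.fun_add dc).const_mul 2)
    rw [dd.deriv]
    have e0 : pds 0 F0 t x = -1 * (v (t, x) * pds 0 H t x + H (t, x) * pds 0 v t x)
      + 2 * (v (t, x) * pds 0 (fun q => pds 0 v q.1 q.2) t x + pds 0 v t x * pds 0 v t x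
        + (w (t, x) * pds 0 (fun q => pds 0 w q.1 q.2) t x + pds 0 w t x * pds 0 w t x))
      + 2 * (v (t, x) * pds 0 (fun q => a q * a q + b q * b q) t x
        + (a (t, x) * a (t, x) + b (t, x) * b (t, x)) * pds 0 v t x
        + (w (t, x) * pds 0 (fun q => a q * b q + b q * c q) t x
        + (a (t, x) * b (t, x) + b (t, x) * c (t, x)) * pds 0 w t x))
      + 4 * (v (t, x) * pds 0 a t x + a (t, x) * pds 0 v t x
        + (w (t, x) * pds 0 b t x + b (t, x) * pds 0 w t x)) := by
      clear_value H
      simp (disch := fun_prop) only [F0, pds_add', pds_cmul', pds_mul']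
    have e1 : pds 1 F1 t x = -1 * (w (t, x) * pds 1 H t x + H (t, x) * pds 1 w t x)
      + 2 * (v (t, x) * pds 1 (fun q => pds 1 v q.1 q.2) t x + pds 1 v t x * pds 1 v t x
        + (w (t, x) * pds 1 (fun q => pds 1 w q.1 q.2) t x + pds 1 w t x * pds 1 w t x))
      + 2 * (v (t, x) * pds 1 (fun q => b q * a q + c q * b q) t x
        + (b (t, x) * a (t, x) + c (t, x) * b (t, x)) * pds 1 v t x
        + (w (t, x) * pds 1 (fun q => b q * b q + c q * c q) t x
        + (b (t, x) * b (t, x) + c (t, x) * c (t, x)) * pds 1 w t x))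
      + 4 * (v (t, x) * pds 1 b t x + b (t, x) * pds 1 v t x
        + (w (t, x) * pds 1 c t x + c (t, x) * pds 1 w t x)) := by
      clear_value H
      simp (disch := fun_prop) only [F1, pds_add', pds_cmul', pds_mul']
    rw [e0, e1, hHd, hHd]
    clear_value H
    linear_combination 2 * v (t, x) * hm0 x + 2 * w (t, x) * hm1 x
      + (2 * a (t, x) + 2) * hs00 x + 4 * b (t, x) * hs01 x + (2 * c (t, x) + 2) * hs11 x
      + (H (t, x) + 2) * hdiv x
  have i0 := pds_integrable 0 hF0 hK z0 t
  have i1 := pds_integrable 1 hF1 hK z1 t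
  simp_rw [pt]
  have i01 : Integrable (fun x => pds 0 F0 t x + pds 1 F1 t x) := i0.add i1
  rw [integral_add (hgi.const_mul _) i01, integral_add i0 i1,
    pds_integral 0 hF0 hK z0 t, pds_integral 1 hF1 hK z1 t, integral_const_mul]
  simp

/-- Basic energy law: for `C²` solutions of the incompressible strain system on
`[0, T]`, compactly supported in space uniformly in time, the energy
`E(t) = ∫ (|u|² + |V|² + 2 tr V) dx` is differentiable on `[0, T]` with
`E'(t) = -2 ∫ |∇u|² dx`. -/
theorem basic_energy_law (T : ℝ) (hT : 0 < T)
    (u : ℝ × (Fin 2 → ℝ) → (Fin 2 → ℝ)) (p : ℝ × (Fin 2 → ℝ) → ℝ)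
    (V : ℝ × (Fin 2 → ℝ) → Matrix (Fin 2) (Fin 2) ℝ)
    (γ : ℝ × (Fin 2 → ℝ) → ℝ)
    (hu : ∀ j, ContDiff ℝ 2 fun q => u q j) (hp : ContDiff ℝ 2 p)
    (hV : ∀ i j, ContDiff ℝ 2 fun q => V q i j) (hγ : ContDiff ℝ 2 γ)
    (hsym : ∀ t x, (V (t, x))ᵀ = V (t, x))
    (hsupp : ∃ K : Set (Fin 2 → ℝ), IsCompact K ∧ ∀ t x, x ∉ K →
      u (t, x) = 0 ∧ p (t, x) = 0 ∧ V (t, x) = 0 ∧ γ (t, x) = 0)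
    (hdiv : ∀ t ∈ Set.Icc (0 : ℝ) T, ∀ x,
      ∑ i, pds i (fun q => u q i) t x = 0)
    (hmom : ∀ t ∈ Set.Icc (0 : ℝ) T, ∀ x (j : Fin 2),
      deriv (fun s => u (s, x) j) t
          + (∑ k, u (t, x) k * pds k (fun q => u q j) t x) + pds j p t x
        = (∑ i, pds i (fun q => pds i (fun r => u r j) q.1 q.2) t x)
            + matDivs (fun q => V q * (V q)ᵀ) t x j + 2 * matDivs V t x j)
    (hstrain : ∀ t ∈ Set.Icc (0 : ℝ) T, ∀ x (i j : Fin 2),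
      deriv (fun s => V (s, x) i j) t
          + ∑ k, u (t, x) k * pds k (fun q => V q i j) t x
        = ((2⁻¹ : ℝ) • (gradMats u t x + (gradMats u t x)ᵀ)
            + (2⁻¹ : ℝ) •
                (gradMats u t x * V (t, x) + V (t, x) * (gradMats u t x)ᵀ)
            + ((2⁻¹ : ℝ) * ((2⁻¹ : ℝ) *
                    (pds 1 (fun q => u q 0) t x - pds 0 (fun q => u q 1) t x)
                  - γ (t, x))) •
                (V (t, x) * Arot - Arot * V (t, x))) i j) :
    ∀ t ∈ Set.Icc (0 : ℝ) T,
      HasDerivWithinAt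
        (fun s => ∫ x : Fin 2 → ℝ,
          ((∑ i, (u (s, x) i) ^ 2) + (∑ i, ∑ j, (V (s, x) i j) ^ 2)
            + 2 * (V (s, x)).trace))
        (-2 * ∫ x : Fin 2 → ℝ, ∑ i, ∑ j, (pds i (fun q => u q j) t x) ^ 2)
        (Set.Icc (0 : ℝ) T) t := by
  
  obtain ⟨K, hK, h0⟩ := hsupp
  intro t ht
  have hs : ∀ q, V q 1 0 = V q 0 1 := by
    intro q
    exact congrFun (congrFun (hsym q.1 q.2) 0) 1
  have hm0 := fun x => hmom t ht x 0
  have hm1 := fun x => hmom t ht x 1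
  have hs00 := fun x => hstrain t ht x 0 0
  have hs01 := fun x => hstrain t ht x 0 1
  have hs11 := fun x => hstrain t ht x 1 1
  have hd := fun x => hdiv t ht x
  simp only [matDivs, Fin.sum_univ_two, Matrix.mul_apply, Matrix.transpose_apply, hs]
    at hm0 hm1 hd
  have A00 : Arot 0 0 = 0 := rfl
  have A01 : Arot 0 1 = -1 := rfl
  have A10 : Arot 1 0 = 1 := rfl
  have A11 : Arot 1 1 = 0 := rfl
  simp only [gradMats, Matrix.add_apply, Matrix.sub_apply, Matrix.smul_apply, smul_eq_mul,
    Matrix.transpose_apply, Matrix.of_apply, A00, A01, A10, A11,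
    Matrix.mul_apply, Fin.sum_univ_two, hs] at hs00 hs01 hs11
  have := core (hu 0) (hu 1) hp (hV 0 0) (hV 0 1) (hV 1 1) hK
    (fun t x hx => by simp [(h0 t x hx).1]) (fun t x hx => by simp [(h0 t x hx).1])
    (fun t x hx => by simp [(h0 t x hx).2.2.1]) (fun t x hx => by simp [(h0 t x hx).2.2.1])
    (fun t x hx => by simp [(h0 t x hx).2.2.1]) t
    (fun x => (2⁻¹ : ℝ) * ((2⁻¹ : ℝ) *
                    (pds 1 (fun q => u q 0) t x - pds 0 (fun q => u q 1) t x)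
                  - γ (t, x)))
    hd hm0 hm1
    (fun x => by linear_combination hs00 x) (fun x => by linear_combination hs01 x)
    (fun x => by linear_combination hs11 x)
  simp only [Fin.sum_univ_two, Matrix.trace, Matrix.diag_apply, hs]
  exact this.hasDerivWithinAt
end

section
/- Let p : ℝ² → ℝ be C² and compactly supported, let V : ℝ² → Matrix (Fin 2) (Fin 2) ℝ be C² with V(x) symmetric and I₂ + V(x) invertible for every x, and let θ : ℝ² → ℝ be C² with the constraint ∇·V = A (I₂ + V) ∇θ holding pointwise. Then ∫_{ℝ²} (∇·V) · ∇p dx = − ∫_{ℝ²} ∇p · [ A V (I₂ + V)^{-1} A (∇·V) ] dx. -/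
open Matrix MeasureTheory

/-- The partial derivative in the `i`-th coordinate direction of a scalar
function on `ℝ²`. -/
noncomputable def pd (i : Fin 2) (f : (Fin 2 → ℝ) → ℝ) (x : Fin 2 → ℝ) : ℝ :=
  fderiv ℝ f x (Pi.single i 1)

/-- The divergence of a matrix field: `(∇·M)_j = Σ_i ∂_i M_{ij}`. -/
noncomputable def matDiv (M : (Fin 2 → ℝ) → Matrix (Fin 2) (Fin 2) ℝ)
    (x : Fin 2 → ℝ) : Fin 2 → ℝ :=
  fun j => ∑ i, pd i (fun y => M y i j) x

lemma pd_contDiff (i : Fin 2) {f : (Fin 2 → ℝ) → ℝ} (hf : ContDiff ℝ 2 f) :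
    ContDiff ℝ 1 (pd i f) := by
  unfold pd
  exact (hf.fderiv_right (m := 1) (by norm_num)).clm_apply contDiff_const

lemma pd_comm {f : (Fin 2 → ℝ) → ℝ} (hf : ContDiff ℝ 2 f) (i j : Fin 2) (x : Fin 2 → ℝ) :
    pd i (pd j f) x = pd j (pd i f) x := by
  have hd : DifferentiableAt ℝ (fderiv ℝ f) x :=
    (hf.fderiv_right (m := 1) (by norm_num)).differentiable (by norm_num) x
  have key : ∀ i j : Fin 2, pd i (pd j f) x
      = fderiv ℝ (fderiv ℝ f) x (Pi.single i 1) (Pi.single j 1) := by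
    intro i j
    have : HasFDerivAt (pd j f) _ x :=
      hd.hasFDerivAt.clm_apply (hasFDerivAt_const (Pi.single j (1:ℝ) : Fin 2 → ℝ) x)
    unfold pd at this ⊢
    rw [this.fderiv]
    simp
  rw [key, key]
  exact (hf.contDiffAt.isSymmSndFDerivAt (by simp)).eq _ _

lemma pd_supp (i : Fin 2) {f : (Fin 2 → ℝ) → ℝ} (hf : HasCompactSupport f) :
    HasCompactSupport (pd i f) := hf.fderiv_apply ℝ _

lemma ibp {p g : (Fin 2 → ℝ) → ℝ} (hp : ContDiff ℝ 2 p) (hcp : HasCompactSupport p)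
    (hg : ContDiff ℝ 1 g) (i : Fin 2) :
    ∫ x, pd i p x * g x = - ∫ x, p x * pd i g x := by
  have hgc : Continuous (pd i g) := by
    unfold pd
    exact (hg.continuous_fderiv (by norm_num)).clm_apply continuous_const
  have := integral_mul_fderiv_eq_neg_fderiv_mul_of_integrable (μ := volume) (f := p) (g := g)
    (v := Pi.single i (1:ℝ))
    (((pd_contDiff i hp).continuous.mul hg.continuous).integrable_of_hasCompactSupport
      ((pd_supp i hcp).mul_right))
    ((hp.continuous.mul hgc).integrable_of_hasCompactSupport hcp.mul_right)
    ((hp.continuous.mul hg.continuous).integrable_of_hasCompactSupport hcp.mul_right)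
    (fun x _ => hp.differentiable (by norm_num) x) (fun x _ => hg.differentiable (by norm_num) x)
  unfold pd
  rw [this, neg_neg]

/-- For a `C²` compactly supported pressure `p` and a `C²` symmetric matrix
field `V` with `I₂ + V` invertible satisfying `∇·V = A (I₂ + V) ∇θ`, one has
`∫ (∇·V) · ∇p dx = - ∫ ∇p · [A V (I₂ + V)⁻¹ A (∇·V)] dx`. -/
theorem integral_divV_dot_grad_pressure
    (p : (Fin 2 → ℝ) → ℝ)
    (V : (Fin 2 → ℝ) → Matrix (Fin 2) (Fin 2) ℝ) (θ : (Fin 2 → ℝ) → ℝ)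
    (hp : ContDiff ℝ 2 p) (hcp : HasCompactSupport p)
    (hV : ∀ i j, ContDiff ℝ 2 fun x => V x i j)
    (hsym : ∀ x, (V x)ᵀ = V x)
    (hinv : ∀ x, IsUnit (1 + V x))
    (hθ : ContDiff ℝ 2 θ)
    (hconstraint : ∀ x,
      matDiv V x = (Arot * (1 + V x)).mulVec fun i => pd i θ x) :
    ∫ x : Fin 2 → ℝ, ∑ j, matDiv V x j * pd j p x
      = -∫ x : Fin 2 → ℝ,
          ∑ j, pd j p x *
            (Arot * V x * (1 + V x)⁻¹ * Arot).mulVec (matDiv V x) j := by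
  have hR : ∀ x, (Arot * V x * (1 + V x)⁻¹ * Arot).mulVec (matDiv V x)
      = - (Arot * V x).mulVec fun i => pd i θ x := by
    intro x
    have hA : Arot * Arot = -1 := by
      ext i j; fin_cases i <;> fin_cases j <;> simp [Arot, Matrix.mul_apply]
    have hdet : IsUnit (1 + V x).det := (Matrix.isUnit_iff_isUnit_det _).1 (hinv x)
    rw [hconstraint, Matrix.mulVec_mulVec, ← Matrix.neg_mulVec]
    congr 1
    calc _ = Arot * V x * ((1 + V x)⁻¹ * ((Arot * Arot) * (1 + V x))) := by
          simp only [Matrix.mul_assoc]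
      _ = _ := by
          rw [hA, neg_mul, one_mul, mul_neg, Matrix.nonsing_inv_mul _ hdet, mul_neg, mul_one]
  simp only [hR]
  simp only [hconstraint]
  have c := fun i => (pd_contDiff i hp).continuous
  have d := fun i => (pd_contDiff i hθ).continuous
  have v := fun i j => (hV i j).continuous
  have int : ∀ (i : Fin 2) (g : (Fin 2 → ℝ) → ℝ), Continuous g →
      Integrable (fun x => pd i p x * g x) := fun i g hg =>
    ((c i).mul hg).integrable_of_hasCompactSupport ((pd_supp i hcp).mul_right)
  have hD : ∫ x, (pd 1 p x * pd 0 θ x - pd 0 p x * pd 1 θ x) = 0 := by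
    rw [integral_sub (int _ _ (d 0)) (int _ _ (d 1)), ibp hp hcp (pd_contDiff 0 hθ),
      ibp hp hcp (pd_contDiff 1 hθ)]
    simp only [pd_comm hθ 1 0]
    ring
  have hI : Integrable (fun x => ∑ j, pd j p x * ((Arot * V x).mulVec fun i => pd i θ x) j) := by
    refine integrable_finsetSum _ fun j _ => int j _ ?_
    simp only [Matrix.mulVec, dotProduct, Matrix.mul_apply]
    fun_prop
  have e : ∀ x, ∑ j, ((Arot * (1 + V x)).mulVec fun i => pd i θ x) j * pd j p x
      = (pd 1 p x * pd 0 θ x - pd 0 p x * pd 1 θ x)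
        + ∑ j, pd j p x * ((Arot * V x).mulVec fun i => pd i θ x) j := by
    intro x
    simp [Matrix.mulVec, dotProduct, Matrix.mul_apply, Fin.sum_univ_two, Arot]
    ring
  simp only [e]
  have hDi : Integrable (fun x => pd 1 p x * pd 0 θ x - pd 0 p x * pd 1 θ x) :=
    (int 1 _ (d 0)).sub (int 0 _ (d 1))
  rw [integral_add hDi hI, hD, zero_add, ← integral_neg]
  simp
end
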